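/- arXiv:1104.0823 — 3 statements merged into one kernel-verified Lean document; each statement's English description precedes it below -/
import Mathlib

section
/- Let q, z be complex numbers with q ≠ 0, z ≠ 0, and let m, n ≥ 1 be integers. Assume q^k ≠ 1 for all 1 ≤ k ≤ n, and z·q^{j-m} ≠ 1 for all 0 ≤ j ≤ m+n-1. Then ∑_{k=1}^{n} [n choose k]_q · (q^m/z;q)_k · (z;q)_{n-k} · z^k / ( (z·q^{-m};q)_{m+n} · (1-q^k)^m ) = − ∑_{k_1=1}^{n} q^{k_1}/((1-z·q^{k_1-1})(1-q^{k_1})) · ∑_{k_2=1}^{k_1} q^{k_2}/((1-z·q^{k_2-2})(1-q^{k_2})) · ⋯ · ∑_{k_m=1}^{k_{m-1}} q^{k_m}/((1-z·q^{k_m-m})(1-q^{k_m})), i.e. the right-hand side is minus the m-fold nested sum over integers 1 ≤ k_m ≤ k_{m-1} ≤ ⋯ ≤ k_1 ≤ n of ∏_{i=1}^{m} q^{k_i}/((1-z·q^{k_i-i})(1-q^{k_i})). -/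
open Finset

/-- The q-Pochhammer symbol `(x;q)_N = ∏_{j=0}^{N-1} (1 - x q^j)`. -/
noncomputable def qPoch (q x : ℂ) (N : ℕ) : ℂ := ∏ j ∈ Finset.range N, (1 - x * q ^ j)

/-- The Gaussian binomial coefficient `[n choose k]_q = (q;q)_n / ((q;q)_k (q;q)_{n-k})`. -/
noncomputable def qBinom (q : ℂ) (n k : ℕ) : ℂ := qPoch q q n / (qPoch q q k * qPoch q q (n - k))

/-- `nestedSum f i r N = ∑_{1 ≤ k_r ≤ ⋯ ≤ k_1 ≤ N} ∏_{s=1}^{r} f (i+s-1) k_s`: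
the `r`-fold nested sum `∑_{k_1=1}^{N} f i k_1 ∑_{k_2=1}^{k_1} f (i+1) k_2 ⋯`. -/
noncomputable def nestedSum (f : ℕ → ℕ → ℂ) : ℕ → ℕ → ℕ → ℂ
  | _, 0, _ => 1
  | i, r + 1, N => ∑ k ∈ Finset.Icc 1 N, f i k * nestedSum f (i + 1) r k

theorem qPoch_zero (q x : ℂ) : qPoch q x 0 = 1 := by simp [qPoch]

theorem qPoch_succ (q x : ℂ) (N : ℕ) :
    qPoch q x (N + 1) = qPoch q x N * (1 - x * q ^ N) :=
  Finset.prod_range_succ _ _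

theorem qPoch_succ_left (q x : ℂ) (N : ℕ) :
    qPoch q x (N + 1) = (1 - x) * qPoch q (x * q) N := by
  simp only [qPoch, Finset.prod_range_succ', pow_zero, mul_one, pow_succ']
  rw [mul_comm]
  congr 1
  exact Finset.prod_congr rfl fun j _ => by ring

theorem qPoch_ne_zero {q x : ℂ} {N : ℕ} (h : ∀ j < N, x * q ^ j ≠ 1) : qPoch q x N ≠ 0 :=
  Finset.prod_ne_zero_iff.mpr fun j hj => sub_ne_zero.mpr (h j (Finset.mem_range.mp hj)).symm

theorem qPoch_self_ne_zero {q : ℂ} {n N : ℕ} (h : ∀ k : ℕ, 1 ≤ k → k ≤ n → q ^ k ≠ 1)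
    (hN : N ≤ n) : qPoch q q N ≠ 0 :=
  qPoch_ne_zero fun j hj => by
    rw [← pow_succ']
    exact h (j + 1) (by omega) (by omega)

theorem nestedSum_add_one (f : ℕ → ℕ → ℂ) (i r N : ℕ) :
    nestedSum f (i + 1) r N = nestedSum (fun i => f (i + 1)) i r N := by
  induction r generalizing i N with
  | zero => rfl
  | succ r ih => simp only [nestedSum, ih]

/-- Partial sums of the `q`-Chu–Vandermonde sum `∑ [n choose k] (1/z;q)_k (z;q)_{n-k} z^k`. -/
theorem sum_range_qBinom_mul_qPoch {q z : ℂ} (hz : z ≠ 0) {n : ℕ}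
    (hq1 : ∀ k : ℕ, 1 ≤ k → k ≤ n + 1 → q ^ k ≠ 1) (j : ℕ) (hj : j ≤ n) :
    ∑ k ∈ Finset.range (j + 1),
        qBinom q (n + 1) k * qPoch q (1 / z) k * qPoch q z (n + 1 - k) * z ^ k
      = qBinom q n j * qPoch q (q / z) j * qPoch q z (n + 1 - j) * z ^ j := by
  induction j with
  | zero =>
    have h := qPoch_self_ne_zero hq1 le_rfl
    have h' := qPoch_self_ne_zero hq1 n.le_succ
    simp [qBinom, qPoch_zero, h, h']
  | succ j ih =>
    rw [Finset.sum_range_succ, ih (by omega)]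
    obtain ⟨d, rfl⟩ := Nat.exists_eq_add_of_le hj
    have e1 : j + 1 + d + 1 - j = d + 1 + 1 := by omega
    have e2 : j + 1 + d + 1 - (j + 1) = d + 1 := by omega
    have e3 : j + 1 + d - j = d + 1 := by omega
    have e4 : j + 1 + d - (j + 1) = d := by omega
    have e5 : 1 / z * q = q / z := by ring
    have hJ := qPoch_self_ne_zero (N := j) hq1 (by omega)
    have hD := qPoch_self_ne_zero (N := d) hq1 (by omega)
    have hj1 : 1 - q * q ^ j ≠ 0 := by
      rw [← pow_succ', sub_ne_zero]; exact (hq1 _ (by omega) (by omega)).symm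
    have hd1 : 1 - q * q ^ d ≠ 0 := by
      rw [← pow_succ', sub_ne_zero]; exact (hq1 _ (by omega) (by omega)).symm
    simp only [qBinom, e1, e2, e3, e4]
    rw [qPoch_succ q q (j + 1 + d), qPoch_succ_left q (1 / z) j, e5, qPoch_succ q z (d + 1),
      qPoch_succ q q j, qPoch_succ q q d, qPoch_succ q (q / z) j]
    simp only [pow_add, pow_one]
    field_simp
    ring

theorem sum_Icc_qBinom_mul_qPoch {q z : ℂ} (hz : z ≠ 0) {n : ℕ} (hn : 1 ≤ n)
    (hq1 : ∀ k : ℕ, 1 ≤ k → k ≤ n → q ^ k ≠ 1) :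
    ∑ k ∈ Finset.Icc 1 n, qBinom q n k * qPoch q (1 / z) k * qPoch q z (n - k) * z ^ k
      = - qPoch q z n := by
  obtain ⟨n, rfl⟩ := Nat.exists_eq_add_of_le' hn
  have h := sum_range_qBinom_mul_qPoch hz hq1 n le_rfl
  have hP := qPoch_self_ne_zero hq1 le_rfl
  have hP' := qPoch_self_ne_zero hq1 n.le_succ
  have e5 : 1 / z * q = q / z := by ring
  have total : ∑ k ∈ Finset.range (n + 1 + 1),
      qBinom q (n + 1) k * qPoch q (1 / z) k * qPoch q z (n + 1 - k) * z ^ k = 0 := by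
    rw [Finset.sum_range_succ, h, qPoch_succ_left q (1 / z) n, e5]
    simp only [qBinom, Nat.sub_self, Nat.add_sub_cancel_left, qPoch_zero, mul_one,
      div_self hP, div_self hP', qPoch_succ_left q z 0]
    field_simp
    ring
  rw [Finset.range_eq_Ico, Finset.sum_eq_sum_Ico_succ_bot (by omega)] at total
  have h0 : qBinom q (n + 1) 0 = 1 := by simp [qBinom, qPoch_zero, hP]
  rw [h0] at total
  simp only [qPoch_zero, Nat.sub_zero, pow_zero, mul_one, one_mul] at total
  exact eq_neg_of_add_eq_zero_right total

/-- The summand on the left-hand side of `stmt_1`. -/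
noncomputable def qSummand (q z : ℂ) (m n k : ℕ) : ℂ :=
  qBinom q n k * qPoch q (q ^ m / z) k * qPoch q z (n - k) * z ^ k
    / (qPoch q (z * q ^ (-(m : ℤ))) (m + n) * (1 - q ^ k) ^ m)

theorem mul_zpow_neg_succ {q : ℂ} (hq : q ≠ 0) (z : ℂ) (m : ℕ) :
    z * q ^ (-((m + 1 : ℕ) : ℤ)) = z / q * q ^ (-(m : ℤ)) := by
  rw [show (-((m + 1 : ℕ) : ℤ)) = -(m : ℤ) - 1 by push_cast; ring, zpow_sub_one₀ hq]
  ring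

theorem div_mul_zpow_neg_mul_pow {q : ℂ} (hq : q ≠ 0) (z : ℂ) (m n : ℕ) :
    z / q * q ^ (-(m : ℤ)) * q ^ (m + (n + 1)) = z * q ^ n := by
  rw [zpow_neg, zpow_natCast, pow_add, pow_succ]
  field_simp

theorem qPoch_shifted_ne_zero {q z : ℂ} (hq : q ≠ 0) {m n : ℕ}
    (hz1 : ∀ j : ℕ, j < m + n → z * q ^ ((j : ℤ) - (m : ℤ)) ≠ 1) :
    qPoch q (z * q ^ (-(m : ℤ))) (m + n) ≠ 0 :=
  qPoch_ne_zero fun j hj => by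
    rw [mul_assoc, ← zpow_natCast q j, ← zpow_add₀ hq, neg_add_eq_sub]
    exact hz1 j hj

theorem qSummand_succ {q z : ℂ} (hq : q ≠ 0) (hz : z ≠ 0) {m n k : ℕ} (hk : 1 ≤ k) (hkn : k ≤ n)
    (hq1 : ∀ k : ℕ, 1 ≤ k → k ≤ n + 1 → q ^ k ≠ 1)
    (hz1 : ∀ j : ℕ, j < m + 1 + (n + 1) → z * q ^ ((j : ℤ) - ((m + 1 : ℕ) : ℤ)) ≠ 1) :
    qSummand q z (m + 1) (n + 1) k = qSummand q z (m + 1) n k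
      + q ^ (n + 1) / ((1 - z * q ^ n) * (1 - q ^ (n + 1))) * qSummand q (z / q) m (n + 1) k := by
  have hW := qPoch_shifted_ne_zero hq hz1
  have e0 : m + 1 + (n + 1) = m + (n + 1) + 1 := by omega
  have e1 : m + 1 + n = m + (n + 1) := by omega
  rw [mul_zpow_neg_succ hq, e0, qPoch_succ, div_mul_zpow_neg_mul_pow hq] at hW
  have hW1 := left_ne_zero_of_mul hW
  have hW2 := right_ne_zero_of_mul hW
  obtain ⟨d, rfl⟩ := Nat.exists_eq_add_of_le hkn
  have hK := qPoch_self_ne_zero (N := k) hq1 (by omega)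
  have hD := qPoch_self_ne_zero (N := d) hq1 (by omega)
  have hd1 : 1 - q * q ^ d ≠ 0 := by
    rw [← pow_succ', sub_ne_zero]; exact (hq1 _ (by omega) (by omega)).symm
  have hk1 : 1 - q ^ k ≠ 0 := sub_ne_zero.mpr (hq1 _ (by omega) (by omega)).symm
  have hn1 : 1 - q * q ^ (k + d) ≠ 0 := by
    rw [← pow_succ', sub_ne_zero]; exact (hq1 _ (by omega) (by omega)).symm
  have e2 : k + d + 1 - k = d + 1 := by omega
  have e3 : q ^ m / (z / q) = q ^ (m + 1) / z := by rw [pow_succ, div_div_eq_mul_div]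
  simp only [qSummand, qBinom, e2, Nat.add_sub_cancel_left, mul_zpow_neg_succ hq]
  rw [e0, e1, e3, qPoch_succ q _ (m + (k + d + 1)), div_mul_zpow_neg_mul_pow hq,
    qPoch_succ q q (k + d), qPoch_succ q q d, qPoch_succ q z d, qPoch_succ_left q (z / q) d,
    div_mul_cancel₀ z hq, div_pow, pow_succ' q (k + d), pow_succ (1 - q ^ k) m]
  have hkm := pow_ne_zero m hk1
  generalize qPoch q (z / q * q ^ (-(m : ℤ))) (m + (k + d + 1)) = W at *
  generalize qPoch q (q ^ (m + 1) / z) k = X at *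
  generalize (1 - q ^ k) ^ m = Y at *
  generalize qPoch q z d = Z at *
  generalize qPoch q q (k + d) = Q at *
  generalize qPoch q q k = K at *
  generalize qPoch q q d = D at *
  rw [pow_add] at hW2 hn1 ⊢
  have hA := pow_ne_zero k hq
  generalize q ^ k = A at *
  generalize q ^ d = B at *
  rw [← mul_assoc] at hn1
  generalize hU : 1 - z * (A * B) = U at *
  field_simp
  rw [← hU]
  ring

theorem qSummand_succ_self {q z : ℂ} (hq : q ≠ 0) {m n : ℕ}
    (hq1 : ∀ k : ℕ, 1 ≤ k → k ≤ n + 1 → q ^ k ≠ 1)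
    (hz1 : ∀ j : ℕ, j < m + 1 + (n + 1) → z * q ^ ((j : ℤ) - ((m + 1 : ℕ) : ℤ)) ≠ 1) :
    qSummand q z (m + 1) (n + 1) (n + 1) =
      q ^ (n + 1) / ((1 - z * q ^ n) * (1 - q ^ (n + 1)))
        * qSummand q (z / q) m (n + 1) (n + 1) := by
  have hW := qPoch_shifted_ne_zero hq hz1
  have e0 : m + 1 + (n + 1) = m + (n + 1) + 1 := by omega
  rw [mul_zpow_neg_succ hq, e0, qPoch_succ, div_mul_zpow_neg_mul_pow hq] at hW
  have hW1 := left_ne_zero_of_mul hW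
  have hW2 := right_ne_zero_of_mul hW
  have hn1 : 1 - q ^ (n + 1) ≠ 0 := sub_ne_zero.mpr (hq1 _ (by omega) le_rfl).symm
  have e3 : q ^ m / (z / q) = q ^ (m + 1) / z := by rw [pow_succ, div_div_eq_mul_div]
  simp only [qSummand, Nat.sub_self, qPoch_zero, mul_zpow_neg_succ hq]
  rw [e0, e3, qPoch_succ q _ (m + (n + 1)), div_mul_zpow_neg_mul_pow hq, div_pow,
    pow_succ (1 - q ^ (n + 1)) m]
  have hkm := pow_ne_zero m hn1
  have hqn := pow_ne_zero (n + 1) hq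
  generalize qPoch q (z / q * q ^ (-(m : ℤ))) (m + (n + 1)) = W at *
  generalize qPoch q (q ^ (m + 1) / z) (n + 1) = X at *
  generalize (1 - q ^ (n + 1)) ^ m = Y at *
  field_simp

theorem sum_qSummand_eq_neg_nestedSum {q : ℂ} (hq : q ≠ 0) (m n : ℕ) (z : ℂ) (hz : z ≠ 0)
    (hmn : 1 ≤ m ∨ 1 ≤ n) (hq1 : ∀ k : ℕ, 1 ≤ k → k ≤ n → q ^ k ≠ 1)
    (hz1 : ∀ j : ℕ, j < m + n → z * q ^ ((j : ℤ) - (m : ℤ)) ≠ 1) :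
    ∑ k ∈ Finset.Icc 1 n, qSummand q z m n k
      = - nestedSum (fun i k => q ^ k / ((1 - z * q ^ ((k : ℤ) - (i : ℤ))) * (1 - q ^ k)))
          1 m n := by
  induction m generalizing n z with
  | zero =>
    have hn : 1 ≤ n := by omega
    have hW := qPoch_shifted_ne_zero hq hz1
    have h := sum_Icc_qBinom_mul_qPoch hz hn hq1
    simp only [Nat.cast_zero, neg_zero, zpow_zero, mul_one, zero_add] at hW
    simp only [qSummand, nestedSum, Nat.cast_zero, neg_zero, zpow_zero, mul_one, zero_add,
      pow_zero, ← Finset.sum_div, h]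
    rw [neg_div, div_self hW]
  | succ m ihm =>
    clear hmn
    induction n with
    | zero => simp [nestedSum]
    | succ n ihn =>
      have hprev := ihn (fun k h1 h2 => hq1 k h1 (by omega)) (fun j hj => hz1 j (by omega))
      have hstep := ihm (n + 1) (z / q) (div_ne_zero hz hq) (by omega) hq1 fun j hj => by
        have h := hz1 j (by omega)
        rwa [show (j : ℤ) - ((m + 1 : ℕ) : ℤ) = (j : ℤ) - m - 1 by push_cast; ring,
          zpow_sub_one₀ hq, mul_comm (q ^ _), ← mul_assoc, ← div_eq_mul_inv] at h
      have hshift : nestedSum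
            (fun i k => q ^ k / ((1 - z * q ^ ((k : ℤ) - (i : ℤ))) * (1 - q ^ k)))
            (1 + 1) m (n + 1)
          = nestedSum
            (fun i k => q ^ k / ((1 - z / q * q ^ ((k : ℤ) - (i : ℤ))) * (1 - q ^ k)))
            1 m (n + 1) := by
        rw [nestedSum_add_one]
        congr 1
        funext i k
        rw [show (k : ℤ) - ((i + 1 : ℕ) : ℤ) = (k : ℤ) - i - 1 by push_cast; ring,
          zpow_sub_one₀ hq, mul_comm (q ^ _) q⁻¹, ← mul_assoc, ← div_eq_mul_inv]
      have hcast : q ^ (((n + 1 : ℕ) : ℤ) - ((1 : ℕ) : ℤ)) = q ^ n := by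
        rw [← zpow_natCast]; congr 1; push_cast; ring
      rw [nestedSum, Finset.sum_Icc_succ_top (by omega), Finset.sum_Icc_succ_top (by omega),
        hshift, neg_add, ← mul_neg, ← hstep,
        hcast]
      rw [nestedSum] at hprev
      rw [← hprev, Finset.sum_Icc_succ_top (by omega),
        qSummand_succ_self hq hq1 hz1, mul_add, ← add_assoc, Finset.mul_sum,
        ← Finset.sum_add_distrib]
      congr 1
      refine Finset.sum_congr rfl fun k hk => ?_
      rw [Finset.mem_Icc] at hk
      exact qSummand_succ hq hz hk.1 hk.2 hq1 hz1

theorem stmt_1 (q z : ℂ) (hq : q ≠ 0) (hz : z ≠ 0) (m n : ℕ) (hm : 1 ≤ m) (hn : 1 ≤ n)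
    (hq1 : ∀ k : ℕ, 1 ≤ k → k ≤ n → q ^ k ≠ 1)
    (hz1 : ∀ j : ℕ, j < m + n → z * q ^ ((j : ℤ) - (m : ℤ)) ≠ 1) :
    ∑ k ∈ Finset.Icc 1 n,
        qBinom q n k * qPoch q (q ^ m / z) k * qPoch q z (n - k) * z ^ k
          / (qPoch q (z * q ^ (-(m : ℤ))) (m + n) * (1 - q ^ k) ^ m)
      = - nestedSum (fun i k => q ^ k / ((1 - z * q ^ ((k : ℤ) - (i : ℤ))) * (1 - q ^ k)))
          1 m n :=
  sum_qSummand_eq_neg_nestedSum hq m n z hz (Or.inl hm) hq1 hz1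
end

section
/- Let q, z be complex numbers with q ≠ 0, z ≠ 0, and let n ≥ 0 and m be integers with 0 ≤ m ≤ n. Assume q^j ≠ 1 for all 1 ≤ j ≤ n, and z·q^{k-m} ≠ 1 for all 0 ≤ k ≤ n-1. Then ∑_{k=0, k≠m}^{n} [n choose k]_q · (q/z;q)_k · (z;q)_{n-k} · z^k / (1 - q^{k-m}) = (-1)^m · q^{m(m+1)/2} · [n choose m]_q · (z·q^{-m};q)_n · ( ∑_{k=0}^{n-1} z·q^{k-m}/(1 - z·q^{k-m}) − ∑_{k=0, k≠m}^{n} q^{k-m}/(1 - q^{k-m}) ). -/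
open Finset

open Polynomial in
theorem eval_derivative_prod_one_sub_C_mul_X {K ι : Type*} [Field K] (s : Finset ι) (a : ι → K)
    (x : K) (h : ∀ i ∈ s, 1 - a i * x ≠ 0) :
    (derivative (∏ i ∈ s, (1 - C (a i) * X))).eval x
      = -((∏ i ∈ s, (1 - a i * x)) * ∑ i ∈ s, a i / (1 - a i * x)) := by
  classical
  induction s using Finset.induction_on with
  | empty => simp
  | insert i s hi ih =>
    have hne := h i (mem_insert_self i s)
    rw [prod_insert hi, prod_insert hi, sum_insert hi, derivative_mul, eval_add, eval_mul, eval_mul,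
      ih fun j hj => h j (mem_insert_of_mem hj), eval_prod]
    simp only [derivative_sub, derivative_one, derivative_C_mul, derivative_X, eval_sub, eval_mul,
      eval_C, eval_X, eval_one, zero_sub, mul_one, eval_neg]
    have hdiv : (1 - a i * x) * (a i / (1 - a i * x)) = a i :=
      mul_div_cancel_of_imp' fun h => absurd h hne
    linear_combination (∏ j ∈ s, (1 - a j * x)) * hdiv

theorem Polynomial.degree_prod_one_sub_C_mul_X_le {K ι : Type*} [Field K] (s : Finset ι)
    (a : ι → K) : degree (∏ i ∈ s, (1 - C (a i) * X)) ≤ (#s : WithBot ℕ) := by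
  refine (degree_prod_le _ _).trans ?_
  calc ∑ i ∈ s, degree (1 - C (a i) * X) ≤ ∑ _i ∈ s, (1 : WithBot ℕ) :=
        sum_le_sum fun i _ => by compute_degree
    _ = #s := by simp

/-- Lagrange interpolation at the points `(a k)⁻¹`. -/
theorem Polynomial.eq_sum_prod_one_sub_C_mul_X {K ι : Type*} [Field K] [DecidableEq ι]
    (s : Finset ι) (a : ι → K) (ha : ∀ i ∈ s, a i ≠ 0) (hinj : Set.InjOn a s)
    (P : Polynomial K) (hP : P.degree < #s) (c : ι → K)
    (hc : ∀ k ∈ s, P.eval (a k)⁻¹ = c k * ∏ j ∈ s.erase k, (1 - a j * (a k)⁻¹)) :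
    P = ∑ k ∈ s, C (c k) * ∏ j ∈ s.erase k, (1 - C (a j) * X) := by
  refine eq_of_degrees_lt_of_eval_index_eq s (v := fun k => (a k)⁻¹)
    (fun i hi j hj hij => hinj hi hj (inv_injective hij)) hP ?_ ?_
  · rw [← mem_degreeLT]
    refine Submodule.sum_mem _ fun k hk => ?_
    rw [mem_degreeLT]
    rw [← smul_eq_C_mul]
    refine (degree_smul_le _ _).trans_lt ((degree_prod_one_sub_C_mul_X_le _ a).trans_lt ?_)
    exact_mod_cast card_erase_lt_of_mem hk
  · intro k hk
    rw [hc k hk, eval_finsetSum, sum_eq_single_of_mem k hk]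
    · simp [eval_prod]
    · intro i _ hik
      rw [eval_mul, eval_prod, prod_eq_zero (mem_erase.2 ⟨hik.symm, hk⟩), mul_zero]
      simp [ha k hk]

open Polynomial in
theorem eval_derivative_eq_of_interpolation {K ι : Type*} [Field K] [DecidableEq ι]
    (s : Finset ι) (a : ι → K) (ha : ∀ i ∈ s, a i ≠ 0) (hinj : Set.InjOn a s)
    (P : K[X]) (hP : P.degree < #s) (c : ι → K)
    (hc : ∀ k ∈ s, P.eval (a k)⁻¹ = c k * ∏ j ∈ s.erase k, (1 - a j * (a k)⁻¹))
    {m : ι} (hm : m ∈ s) :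
    (derivative P).eval (a m)⁻¹
      = -((∏ j ∈ s.erase m, (1 - a j * (a m)⁻¹)) *
          (c m * ∑ j ∈ s.erase m, a j / (1 - a j * (a m)⁻¹)
            + a m * ∑ k ∈ s.erase m, c k / (1 - a k * (a m)⁻¹))) := by
  have hne : ∀ i ∈ s.erase m, 1 - a i * (a m)⁻¹ ≠ 0 := by
    intro i hi h
    rw [mem_erase] at hi
    refine hi.1 (hinj hi.2 hm ?_)
    rw [sub_eq_zero] at h
    exact eq_of_mul_inv_eq_one h.symm
  conv_lhs => rw [P.eq_sum_prod_one_sub_C_mul_X s a ha hinj hP c hc]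
  rw [derivative_sum, eval_finsetSum, ← add_sum_erase s _ hm]
  rw [derivative_C_mul, eval_mul, eval_C, eval_derivative_prod_one_sub_C_mul_X _ _ _ hne]
  have hterm : ∀ k ∈ s.erase m,
      (derivative (C (c k) * ∏ j ∈ s.erase k, (1 - C (a j) * X))).eval (a m)⁻¹
        = -((∏ j ∈ s.erase m, (1 - a j * (a m)⁻¹)) * a m * (c k / (1 - a k * (a m)⁻¹))) := by
    intro k hk
    have hmk : m ∈ s.erase k := mem_erase.2 ⟨(ne_of_mem_erase hk).symm, hm⟩
    rw [← mul_prod_erase _ _ hmk, ← mul_prod_erase _ _ hk, erase_right_comm, derivative_C_mul,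
      derivative_mul]
    simp only [derivative_sub, derivative_one, derivative_C_mul, derivative_X, eval_sub, eval_mul,
      eval_C, eval_X, eval_one, zero_sub, mul_one, eval_add, eval_prod,
      mul_inv_cancel₀ (ha m hm), sub_self, zero_mul, add_zero, eval_neg]
    have hdiv : (1 - a k * (a m)⁻¹) * (c k / (1 - a k * (a m)⁻¹)) = c k :=
      mul_div_cancel_of_imp' fun h => absurd h (hne k hk)
    linear_combination a m * (∏ j ∈ (s.erase m).erase k, (1 - a j * (a m)⁻¹)) * hdiv
  rw [sum_congr rfl hterm, sum_neg_distrib, ← mul_sum]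
  ring

theorem prod_one_sub_mul_inv_pow (q w : ℂ) (hq : q ≠ 0) (hw : w ≠ 0) (k : ℕ) :
    (∏ j ∈ range k, (1 - w * q ^ j * (q ^ k)⁻¹)) * q ^ (k * (k + 1) / 2)
      = (-w) ^ k * qPoch q (q / w) k := by
  have htri (k : ℕ) : k * (k + 1) / 2 = ∑ i ∈ range k, (i + 1) := by
    have := Finset.sum_range_succ' (fun i => i) k
    rw [add_zero] at this
    rw [← this, Finset.sum_range_id, Nat.add_sub_cancel, mul_comm]
  have hpow : (-w) ^ k = ∏ _i ∈ range k, (-w) := by rw [prod_const, card_range]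
  rw [htri, ← prod_pow_eq_pow_sum, ← prod_range_reflect, ← prod_mul_distrib, qPoch, hpow,
    ← prod_mul_distrib]
  refine prod_congr rfl fun i hi => ?_
  have hk : q ^ k = q ^ (k - 1 - i) * q ^ (i + 1) := by
    rw [← pow_add]
    congr 1
    have := mem_range.1 hi
    omega
  rw [hk]
  field_simp
  ring

theorem qPoch_mul_inv_pow (q z : ℂ) (hq : q ≠ 0) (hz : z ≠ 0) {n k : ℕ} (hk : k ≤ n) :
    qPoch q (z * (q ^ k)⁻¹) n * q ^ (k * (k + 1) / 2)
      = (-z) ^ k * qPoch q (q / z) k * qPoch q z (n - k) := by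
  obtain ⟨d, rfl⟩ := Nat.exists_eq_add_of_le hk
  rw [← prod_one_sub_mul_inv_pow q z hq hz, Nat.add_sub_cancel_left, qPoch, qPoch, prod_range_add]
  have h1 : ∀ j, 1 - z * (q ^ k)⁻¹ * q ^ j = 1 - z * q ^ j * (q ^ k)⁻¹ := fun j => by ring
  have h2 : ∀ j, 1 - z * (q ^ k)⁻¹ * q ^ (k + j) = 1 - z * q ^ j := fun j => by
    rw [pow_add]
    field_simp
  simp only [h2]
  simp only [h1]
  ring

theorem prod_erase_one_sub_pow_mul_inv_pow (q : ℂ) (hq : q ≠ 0) {n k : ℕ} (hk : k ≤ n) :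
    (∏ j ∈ (range (n + 1)).erase k, (1 - q ^ j * (q ^ k)⁻¹)) * q ^ (k * (k + 1) / 2)
      = (-1) ^ k * qPoch q q k * qPoch q q (n - k) := by
  obtain ⟨d, rfl⟩ := Nat.exists_eq_add_of_le hk
  have hsplit : ∏ j ∈ (range (k + d + 1)).erase k, (1 - q ^ j * (q ^ k)⁻¹)
      = (∏ j ∈ range k, (1 - q ^ j * (q ^ k)⁻¹)) * qPoch q q d := by
    have hset : (range (k + d + 1)).erase k
        = range k ∪ (range d).map (addLeftEmbedding (k + 1)) := by
      ext j
      simp only [mem_erase, mem_range, mem_union, mem_map, addLeftEmbedding_apply]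
      refine ⟨fun h => ?_, ?_⟩
      · by_cases hj : j < k
        · exact Or.inl hj
        · exact Or.inr ⟨j - (k + 1), by omega, by omega⟩
      · rintro (h | ⟨i, hi, rfl⟩) <;> omega
    rw [hset, prod_union, prod_map, qPoch]
    · congr 1
      refine prod_congr rfl fun j _ => ?_
      rw [addLeftEmbedding_apply, pow_add, pow_succ]
      field_simp
    · rw [disjoint_left]
      simp only [mem_range, mem_map, addLeftEmbedding_apply, not_exists, not_and]
      intros
      omega
  have h := prod_one_sub_mul_inv_pow q 1 hq one_ne_zero k
  simp only [one_mul, div_one] at h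
  rw [hsplit, Nat.add_sub_cancel_left, ← h]
  ring

theorem qPoch_self_ne_zero_s4 (q : ℂ) {n k : ℕ} (hq : ∀ j : ℕ, 1 ≤ j → j ≤ n → q ^ j ≠ 1)
    (hk : k ≤ n) : qPoch q q k ≠ 0 := by
  refine prod_ne_zero_iff.2 fun j hj => ?_
  rw [← pow_succ']
  exact sub_ne_zero.2 (hq (j + 1) (by omega) (by have := mem_range.1 hj; omega)).symm

theorem pow_injOn_range (q : ℂ) (hq : q ≠ 0) {n : ℕ} (hq1 : ∀ j : ℕ, 1 ≤ j → j ≤ n → q ^ j ≠ 1) :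
    Set.InjOn (fun k : ℕ => q ^ k) (range (n + 1)) := by
  have key : ∀ i j : ℕ, i < j → j ≤ n → q ^ i ≠ q ^ j := by
    intro i j hij hj h
    obtain ⟨d, rfl⟩ := Nat.exists_eq_add_of_le hij.le
    rw [pow_add] at h
    exact hq1 d (by omega) (by omega) (mul_left_cancel₀ (pow_ne_zero i hq) (by rw [← h, mul_one]))
  intro i hi j hj h
  simp only [coe_range, Set.mem_Iio] at hi hj
  rcases lt_trichotomy i j with hij | hij | hij
  · exact absurd h (key i j hij (by omega))
  · exact hij
  · exact absurd h.symm (key j i hij (by omega))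

theorem stmt_4 (q z : ℂ) (hq : q ≠ 0) (hz : z ≠ 0) (n m : ℕ) (hm : m ≤ n)
    (hq1 : ∀ j : ℕ, 1 ≤ j → j ≤ n → q ^ j ≠ 1)
    (hz1 : ∀ k : ℕ, k < n → z * q ^ ((k : ℤ) - (m : ℤ)) ≠ 1) :
    ∑ k ∈ (Finset.range (n + 1)).erase m,
        qBinom q n k * qPoch q (q / z) k * qPoch q z (n - k) * z ^ k
          / (1 - q ^ ((k : ℤ) - (m : ℤ)))
      = (-1) ^ m * q ^ (m * (m + 1) / 2) * qBinom q n m * qPoch q (z * q ^ (-(m : ℤ))) n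
          * ((∑ k ∈ Finset.range n,
                z * q ^ ((k : ℤ) - (m : ℤ)) / (1 - z * q ^ ((k : ℤ) - (m : ℤ))))
             - ∑ k ∈ (Finset.range (n + 1)).erase m,
                q ^ ((k : ℤ) - (m : ℤ)) / (1 - q ^ ((k : ℤ) - (m : ℤ)))) := by
  have hzpow (k : ℕ) : q ^ ((k : ℤ) - (m : ℤ)) = q ^ k * (q ^ m)⁻¹ := by
    rw [zpow_sub₀ hq, zpow_natCast, zpow_natCast, div_eq_mul_inv]
  simp only [hzpow, zpow_neg, zpow_natCast] at hz1 ⊢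
  have hmem : m ∈ range (n + 1) := mem_range.2 (by omega)
  have hinj := pow_injOn_range q hq hq1
  have hqm : q ^ m ≠ 0 := pow_ne_zero m hq
  let c : ℕ → ℂ := fun k => qBinom q n k * qPoch q (q / z) k * qPoch q z (n - k) * z ^ k
  let P : Polynomial ℂ := .C (qPoch q q n) * ∏ j ∈ range n, (1 - .C (z * q ^ j) * .X)
  have hPeval (k : ℕ) : P.eval (q ^ k)⁻¹ = qPoch q q n * qPoch q (z * (q ^ k)⁻¹) n := by
    simp only [P, Polynomial.eval_mul, Polynomial.eval_C, Polynomial.eval_prod, Polynomial.eval_sub,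
      Polynomial.eval_one, Polynomial.eval_X, qPoch, mul_right_comm z]
  have hPdeg : P.degree < #(range (n + 1)) := by
    rw [show P = _ from (Polynomial.smul_eq_C_mul _).symm]
    refine (Polynomial.degree_smul_le _ _).trans_lt
      ((Polynomial.degree_prod_one_sub_C_mul_X_le _ fun j => z * q ^ j).trans_lt ?_)
    rw [card_range, card_range]
    exact_mod_cast n.lt_succ_self
  have hc : ∀ k ∈ range (n + 1), P.eval (q ^ k)⁻¹
      = c k * ∏ j ∈ (range (n + 1)).erase k, (1 - q ^ j * (q ^ k)⁻¹) := by
    intro k hk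
    have hkn : k ≤ n := by have := mem_range.1 hk; omega
    have h1 := qPoch_self_ne_zero_s4 q hq1 hkn
    have h2 := qPoch_self_ne_zero_s4 q hq1 (Nat.sub_le n k)
    rw [hPeval]
    refine mul_right_cancel₀ (pow_ne_zero (k * (k + 1) / 2) hq) ?_
    rw [mul_assoc, qPoch_mul_inv_pow q z hq hz hkn, mul_assoc (c k),
      prod_erase_one_sub_pow_mul_inv_pow q hq hkn, neg_pow]
    simp only [c, qBinom]
    field_simp
  have hcm : c m = (-1) ^ m * q ^ (m * (m + 1) / 2) * qBinom q n m
      * qPoch q (z * (q ^ m)⁻¹) n := by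
    have hsq : ((-1 : ℂ) ^ m) * (-1) ^ m = 1 := by rw [← mul_pow]; simp
    have h := qPoch_mul_inv_pow q z hq hz hm
    rw [neg_pow] at h
    simp only [c]
    linear_combination (-(-1) ^ m * qBinom q n m) * h
      - (qBinom q n m * qPoch q (q / z) m * qPoch q z (n - m) * z ^ m) * hsq
  have hDm : ∏ j ∈ (range (n + 1)).erase m, (1 - q ^ j * (q ^ m)⁻¹) ≠ 0 := by
    refine prod_ne_zero_iff.2 fun i hi h => ?_
    rw [mem_erase] at hi
    exact hi.1 (hinj hi.2 hmem (eq_of_mul_inv_eq_one (sub_eq_zero.1 h).symm))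
  have hderiv := eval_derivative_eq_of_interpolation (range (n + 1)) (fun k => q ^ k)
    (fun k _ => pow_ne_zero k hq) hinj P hPdeg c hc hmem
  have hPderiv : (Polynomial.derivative P).eval (q ^ m)⁻¹
      = -(P.eval (q ^ m)⁻¹ * ∑ k ∈ range n, z * q ^ k / (1 - z * q ^ k * (q ^ m)⁻¹)) := by
    have hne : ∀ i ∈ range n, 1 - z * q ^ i * (q ^ m)⁻¹ ≠ 0 := fun i hi h =>
      hz1 i (mem_range.1 hi) (by rw [← mul_assoc]; exact (sub_eq_zero.1 h).symm)
    simp only [P, Polynomial.derivative_C_mul, Polynomial.eval_mul, Polynomial.eval_C]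
    rw [eval_derivative_prod_one_sub_C_mul_X _ _ _ hne, Polynomial.eval_prod]
    simp only [Polynomial.eval_sub, Polynomial.eval_one, Polynomial.eval_mul, Polynomial.eval_C,
      Polynomial.eval_X]
    ring
  rw [hPderiv, hc m hmem] at hderiv
  have hfactor₁ : ∑ k ∈ range n, z * (q ^ k * (q ^ m)⁻¹) / (1 - z * (q ^ k * (q ^ m)⁻¹))
      = (q ^ m)⁻¹ * ∑ k ∈ range n, z * q ^ k / (1 - z * q ^ k * (q ^ m)⁻¹) := by
    rw [mul_sum]
    refine sum_congr rfl fun k _ => ?_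
    rw [← mul_assoc]
    ring
  have hfactor₂ : ∑ k ∈ (range (n + 1)).erase m, q ^ k * (q ^ m)⁻¹ / (1 - q ^ k * (q ^ m)⁻¹)
      = (q ^ m)⁻¹ * ∑ k ∈ (range (n + 1)).erase m, q ^ k / (1 - q ^ k * (q ^ m)⁻¹) := by
    rw [mul_sum]
    exact sum_congr rfl fun k _ => by ring
  rw [← hcm, hfactor₁, hfactor₂]
  change ∑ k ∈ (range (n + 1)).erase m, c k / (1 - q ^ k * (q ^ m)⁻¹) = _
  refine mul_left_cancel₀ (mul_ne_zero hDm hqm) ?_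
  have hinv := mul_inv_cancel₀ hqm
  set D := ∏ j ∈ (range (n + 1)).erase m, (1 - q ^ j * (q ^ m)⁻¹)
  set S := ∑ k ∈ (range (n + 1)).erase m, c k / (1 - q ^ k * (q ^ m)⁻¹)
  set A := ∑ k ∈ range n, z * q ^ k / (1 - z * q ^ k * (q ^ m)⁻¹)
  set B := ∑ k ∈ (range (n + 1)).erase m, q ^ k / (1 - q ^ k * (q ^ m)⁻¹)
  linear_combination hderiv - D * c m * (A - B) * hinv
end

section
/- Let m, n ≥ 1 be integers and let x be a real number such that x + t ≠ 0 for every integer t with −m ≤ t ≤ n−2. Then ∑_{k=1}^{n} C(n,k) · (m−x)_k · (x−1)_{n−k} / ( (x−m)_{m+n−1} · k^m ) = ∑_{1 ≤ k_{m-1} ≤ ⋯ ≤ k_1 ≤ n} ( ∑_{j=1}^{k_{m-1}−1} 1/(x+j−m) − ∑_{j=1}^{k_{m-1}} 1/j ) / ( k_1·k_2⋯k_{m-1} · (x+k_1−2)·(x+k_2−3)⋯(x+k_{m-1}−m) ), with the convention that for m = 1 the outer sum has a single (empty-product) term with k_0 = n. -/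
open Finset

/-- The rising factorial `(x)_N = x (x+1) ⋯ (x+N-1)`. -/
noncomputable def risingFac (x : ℝ) (N : ℕ) : ℝ := ∏ j ∈ Finset.range N, (x + j)

/-- `nestedSumBR f g i r N` is the `r`-fold nested sum
`∑_{k_1=1}^{N} f i k_1 ∑_{k_2=1}^{k_1} f (i+1) k_2 ⋯ ∑_{k_r=1}^{k_{r-1}} f (i+r-1) k_r · g k_r`,
with base value `g N` when `r = 0`. -/
noncomputable def nestedSumBR (f : ℕ → ℕ → ℝ) (g : ℕ → ℝ) : ℕ → ℕ → ℕ → ℝ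
  | _, 0, N => g N
  | i, r + 1, N => ∑ k ∈ Finset.Icc 1 N, f i k * nestedSumBR f g (i + 1) r k

lemma risingFac_succ (x : ℝ) (N : ℕ) :
    risingFac x (N + 1) = risingFac x N * (x + N) := by
  simp [risingFac, Finset.prod_range_succ]

lemma risingFac_succ' (x : ℝ) (N : ℕ) :
    risingFac x (N + 1) = x * risingFac (x + 1) N := by
  simp only [risingFac, Finset.prod_range_succ', Nat.cast_zero, add_zero, mul_comm x]
  congr 1
  refine Finset.prod_congr rfl fun j _ => ?_
  push_cast
  ring

@[simp] lemma risingFac_zero (x : ℝ) : risingFac x 0 = 1 := by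
  simp [risingFac]

/-- The Chu-Vandermonde convolution for rising factorials. -/
lemma sum_antidiagonal_choose_mul_risingFac (a b : ℝ) (n : ℕ) :
    ∑ p ∈ Finset.HasAntidiagonal.antidiagonal n, (n.choose p.1 : ℝ) * (risingFac a p.1 * risingFac b p.2)
      = risingFac (a + b) n := by
  induction n with
  | zero => simp
  | succ n ih =>
    rw [Finset.sum_antidiagonal_choose_succ_mul (fun i j => risingFac a i * risingFac b j) n,
      risingFac_succ, ← ih, Finset.sum_mul, ← Finset.sum_add_distrib]
    refine Finset.sum_congr rfl fun p hp => ?_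
    obtain ⟨i, j⟩ := p
    rw [Finset.HasAntidiagonal.mem_antidiagonal] at hp
    simp only at hp ⊢
    subst hp
    rw [risingFac_succ, risingFac_succ, ← Nat.choose_symm_add]
    push_cast
    ring

lemma sum_Icc_choose_mul_risingFac (a b : ℝ) (n : ℕ) :
    ∑ k ∈ Finset.Icc 1 n, (n.choose k : ℝ) * risingFac a k * risingFac b (n - k)
      = risingFac (a + b) n - risingFac b n := by
  rw [← sum_antidiagonal_choose_mul_risingFac, Finset.Nat.sum_antidiagonal_eq_sum_range_succ_mk,
    Finset.range_eq_Ico, Finset.sum_eq_sum_Ico_succ_bot (Nat.succ_pos n)]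
  simp only [Nat.choose_zero_right, Nat.cast_one, risingFac_zero, one_mul, Nat.sub_zero,
    add_sub_cancel_left, mul_assoc]
  rfl

/-- The left-hand side of the binomial identity, with `m + 1` in place of `m`. -/
noncomputable def binomSum (m n : ℕ) (x : ℝ) : ℝ :=
  ∑ k ∈ Finset.Icc 1 n,
    (n.choose k : ℝ) * risingFac ((m : ℝ) + 1 - x) k * risingFac (x - 1) (n - k)
      / (risingFac (x - (m + 1)) (m + n) * (k : ℝ) ^ (m + 1))

lemma binomSum_succ (m n : ℕ) (x : ℝ) (hx : x + n - 1 ≠ 0) :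
    binomSum m (n + 1) x = binomSum m n x
      + (∑ k ∈ Finset.Icc 1 (n + 1), ((n + 1).choose k : ℝ) * risingFac ((m : ℝ) + 1 - x) k
          * risingFac (x - 2) (n + 1 - k) / (k : ℝ) ^ m)
        / ((n + 1) * risingFac (x - (m + 1)) (m + n + 1)) := by
  have hn : (n : ℝ) + 1 ≠ 0 := by positivity
  have hD : risingFac (x - (m + 1)) (m + n + 1)
      = risingFac (x - (m + 1)) (m + n) * (x + n - 1) := by
    rw [risingFac_succ]
    push_cast
    ring
  unfold binomSum
  rw [Finset.sum_Icc_succ_top (by omega), Finset.sum_Icc_succ_top (by omega), add_div,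
    ← add_assoc (_ : ℝ), Finset.sum_div, ← Finset.sum_add_distrib, ← add_assoc m n 1, hD]
  congr 1
  · refine Finset.sum_congr rfl fun k hk => ?_
    obtain ⟨hk1, hkn⟩ := Finset.mem_Icc.mp hk
    obtain ⟨j, rfl⟩ := Nat.exists_eq_add_of_le hkn
    have hk0 : (k : ℝ) ≠ 0 := by positivity
    have hj : k + j + 1 - k = j + 1 := by omega
    have hC : ((k + j + 1).choose k : ℝ) * (j + 1) = (k + j).choose k * (k + j + 1) := by
      have h := Nat.choose_mul_succ_eq (k + j) k
      rw [hj] at h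
      exact_mod_cast h.symm
    rw [hj, Nat.add_sub_cancel_left, risingFac_succ, risingFac_succ' (x - 2),
      show x - 2 + 1 = x - 1 by ring]
    push_cast at hn hx ⊢
    have hC' : ((k + j).choose k : ℝ) = (k + j + 1).choose k * (j + 1) / (k + j + 1) := by
      rw [hC]
      field_simp
    rw [hC']
    by_cases hR : risingFac (x - (m + 1)) (m + (k + j)) = 0
    · simp [hR]
    · field_simp
      ring
  · have hn' : ((n + 1 : ℕ) : ℝ) = n + 1 := by push_cast; rfl
    rw [Nat.sub_self, hn', pow_succ]
    simp only [risingFac_zero, mul_one, Nat.choose_self, Nat.cast_one, one_mul]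
    rw [div_div]
    congr 1
    ring

lemma binomSum_zero_left (n : ℕ) (x : ℝ)
    (hx : ∀ t : ℤ, -1 ≤ t → t ≤ (n : ℤ) - 2 → x + t ≠ 0) :
    binomSum 0 n x
      = (∑ j ∈ Finset.Icc 1 (n - 1), 1 / (x + j - 1)) - ∑ j ∈ Finset.Icc 1 n, 1 / (j : ℝ) := by
  induction n with
  | zero => simp [binomSum]
  | succ n ih =>
    have hxn : x + n - 1 ≠ 0 := by
      have h := hx (n - 1) (by omega) (by push_cast; omega)
      push_cast at h
      rwa [← add_sub_assoc] at h
    have hx1 : x - 1 ≠ 0 := by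
      have h := hx (-1) le_rfl (by push_cast; omega)
      push_cast at h
      rwa [← sub_eq_add_neg] at h
    rw [binomSum_succ 0 n x hxn, ih fun t h1 h2 => hx t h1 (by push_cast; omega)]
    simp only [pow_zero, div_one, Nat.cast_zero, zero_add]
    rw [sum_Icc_choose_mul_risingFac, show 1 - x + (x - 2) = -1 by ring,
      Finset.sum_Icc_succ_top (by omega) (fun j : ℕ => 1 / (j : ℝ)), Nat.add_sub_cancel]
    rcases n with _ | n
    · simp [risingFac]
      field_simp
      ring
    · have hP : risingFac (x - 1) (n + 1) ≠ 0 := by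
        refine Finset.prod_ne_zero_iff.mpr fun j hj => ?_
        have h := hx (j - 1) (by omega) (by have := Finset.mem_range.mp hj; push_cast; omega)
        push_cast at h
        intro h0
        exact h (by linarith)
      have hneg : risingFac (-1) (n + 1 + 1) = 0 := by
        rw [risingFac_succ', risingFac_succ']
        simp
      rw [hneg, risingFac_succ' (x - 2), show x - 2 + 1 = x - 1 by ring,
        risingFac_succ (x - 1) (n + 1),
        Nat.add_sub_cancel, Finset.sum_Icc_succ_top (by omega) (fun j : ℕ => 1 / (x + j - 1))]
      have hn : ((n : ℝ) + 1 + 1) ≠ 0 := by positivity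
      have hxn' : x - 1 + (n + 1) ≠ 0 := by
        push_cast at hxn
        intro h0
        exact hxn (by linarith)
      push_cast at hxn ⊢
      rw [show x + ((n : ℝ) + 1) - 1 = x - 1 + (n + 1) by ring]
      field_simp
      ring

lemma binomSum_succ_left (m n : ℕ) (x : ℝ)
    (hx : ∀ j < n, x + j - 1 ≠ 0) :
    binomSum (m + 1) n x
      = ∑ k ∈ Finset.Icc 1 n, 1 / ((k : ℝ) * (x + k - 2)) * binomSum m k (x - 1) := by
  induction n with
  | zero => simp [binomSum]
  | succ n ih =>
    have hxn := hx n n.lt_succ_self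
    rw [binomSum_succ _ _ _ hxn, ih fun j hj => hx j (hj.trans n.lt_succ_self),
      Finset.sum_Icc_succ_top (by omega)
        (fun k : ℕ => 1 / ((k : ℝ) * (x + k - 2)) * binomSum m k (x - 1))]
    congr 1
    unfold binomSum
    rw [Finset.sum_div, Finset.mul_sum]
    refine Finset.sum_congr rfl fun k _ => ?_
    rw [risingFac_succ]
    push_cast
    rw [show m + 1 + n = m + (n + 1) by ring, show (m : ℝ) + 1 - (x - 1) = m + 1 + 1 - x by ring,
      show x - 1 - 1 = x - 2 by ring, show x - 1 - ((m : ℝ) + 1) = x - (m + 1 + 1) by ring,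
      show x - ((m : ℝ) + 1 + 1) + (m + 1 + n) = x + (n + 1) - 2 by ring,
      div_div, one_div, inv_mul_eq_div, div_div]
    congr 1
    ring

lemma nestedSumBR_congr {f f' : ℕ → ℕ → ℝ} {g g' : ℕ → ℝ} {i i' : ℕ}
    (hf : ∀ j k, f (i + j) k = f' (i' + j) k) (hg : ∀ k, g k = g' k) (r N : ℕ) :
    nestedSumBR f g i r N = nestedSumBR f' g' i' r N := by
  induction r generalizing i i' N with
  | zero => exact hg N
  | succ r ih =>
    simp only [nestedSumBR]
    refine Finset.sum_congr rfl fun k _ => ?_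
    have h0 := hf 0 k
    simp only [add_zero] at h0
    rw [h0, ih]
    intro j l
    rw [add_assoc, add_assoc, hf]

lemma binomSum_eq_nestedSumBR (m n : ℕ) (x : ℝ)
    (hx : ∀ t : ℤ, -((m : ℤ) + 1) ≤ t → t ≤ (n : ℤ) - 2 → x + t ≠ 0) :
    binomSum m n x = nestedSumBR (fun i k => 1 / ((k : ℝ) * (x + k - i - 1)))
      (fun N => (∑ j ∈ Finset.Icc 1 (N - 1), 1 / (x + j - (m + 1)))
        - ∑ j ∈ Finset.Icc 1 N, 1 / (j : ℝ)) 1 m n := by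
  induction m generalizing n x with
  | zero =>
    rw [binomSum_zero_left n x fun t h1 h2 => hx t (by simpa using h1) h2]
    simp [nestedSumBR]
  | succ m ih =>
    rw [binomSum_succ_left, nestedSumBR]
    · refine Finset.sum_congr rfl fun k hk => ?_
      have hkn := (Finset.mem_Icc.mp hk).2
      rw [ih k (x - 1) fun t h1 h2 => by
        have h := hx (t - 1) (by push_cast; omega) (by omega)
        push_cast at h
        intro h0
        exact h (by linarith)]
      congr 1
      · push_cast
        ring
      · refine nestedSumBR_congr (fun j l => ?_) (fun l => ?_) m k
        · push_cast
          ring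
        · congr 1
          refine Finset.sum_congr rfl fun j _ => ?_
          push_cast
          ring
    · intro j hj h0
      refine hx (j - 1) (by push_cast; omega) (by omega) ?_
      push_cast
      linarith

theorem stmt_15 (m n : ℕ) (hm : 1 ≤ m) (hn : 1 ≤ n) (x : ℝ)
    (hx : ∀ t : ℤ, -(m : ℤ) ≤ t → t ≤ (n : ℤ) - 2 → x + t ≠ 0) :
    ∑ k ∈ Finset.Icc 1 n,
        (n.choose k : ℝ) * risingFac ((m : ℝ) - x) k * risingFac (x - 1) (n - k)
          / (risingFac (x - m) (m + n - 1) * (k : ℝ) ^ m)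
      = nestedSumBR (fun i k => 1 / ((k : ℝ) * (x + k - i - 1)))
          (fun N =>
            (∑ j ∈ Finset.Icc 1 (N - 1), 1 / (x + j - m))
              - ∑ j ∈ Finset.Icc 1 N, 1 / (j : ℝ))
          1 (m - 1) n := by
  obtain ⟨m, rfl⟩ := Nat.exists_eq_add_of_le' hm
  have h := binomSum_eq_nestedSumBR m n x (by exact_mod_cast hx)
  rw [binomSum] at h
  rw [show m + 1 + n - 1 = m + n by omega, Nat.add_sub_cancel]
  push_cast
  exact h
end
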